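/- Let ρ₀, σ₀ ∈ ℂ and let W₀ ∈ Matrix (Fin 2) (Fin 2) ℂ be the matrix with rows (ρ₀, σ₀) and (conj σ₀, conj ρ₀). For r ∈ ℝ set R²(r) = det(W₀ − r•1) = (ρ₀ − r)(conj ρ₀ − r) − σ₀ · conj σ₀ and, whenever R²(r) ≠ 0, W(r) = (R²(r))⁻¹ • (W₀ − r•1). Then at every real r with R²(r) ≠ 0 the matrix-valued function W is differentiable and satisfies the matrix Riccati (Sachs) equation dW/dr = W(r) * W(r). -/

import Mathlib

open Matrix Complex

/-- The matrix `W(r) = (R²(r))⁻¹ • (W₀ − r•1)`, with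
`R²(r) = det(W₀ − r•1) = (ρ₀ − r)(conj ρ₀ − r) − σ₀ conj σ₀`, solves the matrix
Riccati (Sachs) equation `dW/dr = W * W` wherever `R²(r) ≠ 0`. -/
theorem sachs_matrix_riccati_solution (ρ₀ σ₀ : ℂ)
    (W₀ : Matrix (Fin 2) (Fin 2) ℂ)
    (hW₀ : W₀ = !![ρ₀, σ₀; starRingEnd ℂ σ₀, starRingEnd ℂ ρ₀])
    (R2 : ℝ → ℂ)
    (hR2det : ∀ r : ℝ, R2 r = (W₀ - (r : ℂ) • (1 : Matrix (Fin 2) (Fin 2) ℂ)).det)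
    (hR2 : ∀ r : ℝ, R2 r = (ρ₀ - r) * (starRingEnd ℂ ρ₀ - r) - σ₀ * starRingEnd ℂ σ₀)
    (W : ℝ → Matrix (Fin 2) (Fin 2) ℂ)
    (hW : ∀ r : ℝ, W r = (R2 r)⁻¹ • (W₀ - (r : ℂ) • (1 : Matrix (Fin 2) (Fin 2) ℂ)))
    (r : ℝ) (hr : R2 r ≠ 0) :
    ∀ i j : Fin 2, HasDerivAt (fun s : ℝ => W s i j) ((W r * W r) i j) r := by
  have hc : HasDerivAt (fun s : ℝ => (s : ℂ)) 1 r := Complex.ofRealCLM.hasDerivAt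
  have hD : HasDerivAt R2 (-(starRingEnd ℂ ρ₀ - r) - (ρ₀ - r)) r := by
    have h := ((hc.const_sub ρ₀).mul (hc.const_sub (starRingEnd ℂ ρ₀))).sub_const
      (σ₀ * starRingEnd ℂ σ₀)
    have h2 : R2 = fun s : ℝ =>
        (ρ₀ - s) * (starRingEnd ℂ ρ₀ - s) - σ₀ * starRingEnd ℂ σ₀ := funext hR2
    rw [h2]
    refine h.congr_deriv ?_
    ring
  have hI := hD.inv hr
  have key : ∀ a e : ℂ, HasDerivAt (fun s : ℝ => (R2 s)⁻¹ * (a - s * e))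
      (((starRingEnd ℂ ρ₀ - r) + (ρ₀ - r)) / R2 r ^ 2 * (a - r * e) - (R2 r)⁻¹ * e) r := by
    intro a e
    refine (hI.mul ((hc.mul_const e).const_sub a)).congr_deriv ?_
    simp only [Pi.inv_apply]
    ring
  have hr2 := hR2 r
  intro i j
  have hf : (fun s : ℝ => W s i j) = fun s : ℝ =>
      (R2 s)⁻¹ * (W₀ i j - s * (1 : Matrix (Fin 2) (Fin 2) ℂ) i j) := by
    funext s
    simp [hW]
  rw [hf]
  refine (key _ _).congr_deriv ?_
  rw [hW r, hW₀]
  generalize R2 r = D at *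
  fin_cases i <;> fin_cases j <;>
    simp [Matrix.mul_apply, Fin.sum_univ_two] <;> field_simp <;>
    first
    | ring1
    | (rw [hr2]; ring)
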